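/- Call an element c of a dcpo D a coordinate if c ∈ Ir(D) or c ≪ z for some z ∈ Ir(D). Then for every n ≥ 2, in both (Δⁿ, ⊑) and (Ωⁿ, ⊑), every element x is the supremum of the set of coordinates c with c ⊑ x. -/

import Mathlib

open scoped ComplexOrder Matrix

/-- Δⁿ : classical n-states. -/
def IsClassicalState (n : ℕ) (x : Fin n → ℝ) : Prop :=
  (∀ i, 0 ≤ x i) ∧ ∑ i, x i = 1

def ClState (n : ℕ) := {x : Fin n → ℝ // IsClassicalState n x}

/-- The Bayesian order (symmetric characterization). -/
def bayesLE {n : ℕ} (x y : Fin n → ℝ) : Prop :=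
  ∃ σ : Equiv.Perm (Fin n),
    Antitone (fun i => x (σ i)) ∧ Antitone (fun i => y (σ i)) ∧
    ∀ i j : Fin n, (i : ℕ) + 1 = (j : ℕ) →
      x (σ i) * y (σ j) ≤ x (σ j) * y (σ i)

def clLE {n : ℕ} (x y : ClState n) : Prop := bayesLE x.val y.val

/-- Ωⁿ : density matrices on ℂⁿ. -/
def IsDensityMatrix (n : ℕ) (ρ : Matrix (Fin n) (Fin n) ℂ) : Prop :=
  ρ.PosSemidef ∧ ρ.trace = 1

def QState (n : ℕ) := {ρ : Matrix (Fin n) (Fin n) ℂ // IsDensityMatrix n ρ}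

/-- The spectral order on density matrices. -/
def specLE {n : ℕ} (ρ σ : Matrix (Fin n) (Fin n) ℂ) : Prop :=
  ∃ U : Matrix (Fin n) (Fin n) ℂ, U ∈ Matrix.unitaryGroup (Fin n) ℂ ∧
    (Uᴴ * ρ * U).IsDiag ∧ (Uᴴ * σ * U).IsDiag ∧
    bayesLE (fun i => ((Uᴴ * ρ * U) i i).re) (fun i => ((Uᴴ * σ * U) i i).re)

def qLE {n : ℕ} (ρ σ : QState n) : Prop := specLE ρ.val σ.val

/-- `a` is the supremum (least upper bound) of `S` with respect to `le`. -/
def IsLub' {α : Type*} (le : α → α → Prop) (S : Set α) (a : α) : Prop :=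
  (∀ s ∈ S, le s a) ∧ ∀ b, (∀ s ∈ S, le s b) → le a b

/-- `a` is the infimum (greatest lower bound) of `S` with respect to `le`. -/
def IsInf' {α : Type*} (le : α → α → Prop) (S : Set α) (a : α) : Prop :=
  (∀ s ∈ S, le a s) ∧ ∀ b, (∀ s ∈ S, le b s) → le b a

/-- The maximal elements with respect to `le`. -/
def MaxElts {α : Type*} (le : α → α → Prop) : Set α := {x | ∀ y, le x y → y = x}

/-- `x` is irreducible: the infimum of ↑x ∩ max(D) exists and equals x. -/
def Irr {α : Type*} (le : α → α → Prop) : Set α :=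
  {x | IsInf' le {y | le x y ∧ y ∈ MaxElts le} x}

/-- `x ≪ y` : for every (nonempty) directed `S` with supremum `y`
there is `s ∈ S` with `x ⊑ s`. -/
def WayBelow {α : Type*} (le : α → α → Prop) (x y : α) : Prop :=
  ∀ S : Set α, S.Nonempty → DirectedOn le S → IsLub' le S y → ∃ s ∈ S, le x s

/-- `c` is a coordinate: irreducible, or way below some irreducible. -/
def IsCoordinate {α : Type*} (le : α → α → Prop) (c : α) : Prop :=
  c ∈ Irr le ∨ ∃ z ∈ Irr le, WayBelow le c z

section Classical

/-- Pairwise relation underlying the Bayesian order. -/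
def PR {n : ℕ} (x y : Fin n → ℝ) (i j : Fin n) : Prop :=
  x j ≤ x i ∧ y j ≤ y i ∧ x i * y j ≤ x j * y i

/-- Permutation-free version of the Bayesian order. -/
def PW {n : ℕ} (x y : Fin n → ℝ) : Prop := ∀ i j, PR x y i j ∨ PR x y j i

lemma exists_common_sort {n : ℕ} (x y : Fin n → ℝ)
    (h : ∀ i j, (x j ≤ x i ∧ y j ≤ y i) ∨ (x i ≤ x j ∧ y i ≤ y j)) :
    ∃ σ : Equiv.Perm (Fin n), Antitone (fun i => x (σ i)) ∧ Antitone (fun i => y (σ i)) := by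
  let f : Fin n → ℝ := fun i => - (x i + y i)
  have hm := Tuple.monotone_sort f
  refine ⟨Tuple.sort f, ?_, ?_⟩
  · intro i j hij
    have h1 := hm hij
    simp only [f, Function.comp] at h1
    dsimp only
    rcases h (Tuple.sort f i) (Tuple.sort f j) with h2 | h2 <;> simp only [f] at * <;> linarith
  · intro i j hij
    have h1 := hm hij
    simp only [f, Function.comp] at h1
    dsimp only
    rcases h (Tuple.sort f i) (Tuple.sort f j) with h2 | h2 <;> simp only [f] at * <;> linarith

lemma bayes_chain {n : ℕ} {x y : Fin n → ℝ} (hx : ∀ i, 0 ≤ x i) (hy : ∀ i, 0 ≤ y i)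
    (ay : Antitone y)
    (h : ∀ i j : Fin n, (i : ℕ) + 1 = (j : ℕ) → x i * y j ≤ x j * y i) (i : Fin n) :
    ∀ k : ℕ, ∀ hk : (i : ℕ) + k < n, x i * y ⟨i + k, hk⟩ ≤ x ⟨i + k, hk⟩ * y i := by
  intro k
  induction k with
  | zero => intro hk; exact le_refl _
  | succ k ih =>
    intro hk
    have hk' : (i : ℕ) + k < n := by omega
    have h1 := ih hk'
    have h2 := h ⟨i + k, hk'⟩ ⟨i + (k + 1), hk⟩ (by simp; omega)
    have h3 : y ⟨i + (k + 1), hk⟩ ≤ y ⟨i + k, hk'⟩ := ay (by simp [Fin.le_def])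
    generalize (⟨i + (k + 1), hk⟩ : Fin n) = b at *
    generalize (⟨i + k, hk'⟩ : Fin n) = a at *
    rcases (hy a).eq_or_lt with h0 | h0
    · have : y b = 0 := le_antisymm (h0 ▸ h3) (hy b)
      rw [this]; simpa using mul_nonneg (hx b) (hy i)
    · have h4 : (x i * y b) * y a ≤ (x b * y i) * y a := by
        nlinarith [mul_le_mul_of_nonneg_right h1 (hy b), mul_le_mul_of_nonneg_right h2 (hy i)]
      exact le_of_mul_le_mul_right h4 h0

lemma bayes_iff {n : ℕ} {x y : Fin n → ℝ} (hx : ∀ i, 0 ≤ x i) (hy : ∀ i, 0 ≤ y i) :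
    bayesLE x y ↔ PW x y := by
  constructor
  · rintro ⟨σ, ax, ay, h⟩
    have key : ∀ i j : Fin n, i ≤ j → PR x y (σ i) (σ j) := by
      intro i j hij
      refine ⟨ax hij, ay hij, ?_⟩
      have := bayes_chain (x := fun i => x (σ i)) (y := fun i => y (σ i))
        (fun _ => hx _) (fun _ => hy _) ay h i ((j : ℕ) - i)
        (by have := j.2; have := Fin.le_def.1 hij; omega)
      have e : (⟨(i : ℕ) + ((j : ℕ) - i), by have := j.2; have := Fin.le_def.1 hij; omega⟩ : Fin n)
          = j := by ext; have := Fin.le_def.1 hij; simp; omega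
      rw [e] at this
      exact this
    intro i j
    rcases le_total (σ.symm i) (σ.symm j) with hh | hh
    · left; simpa using key _ _ hh
    · right; simpa using key _ _ hh
  · intro h
    obtain ⟨σ, ax, ay⟩ := exists_common_sort x y (fun i j => by
      rcases h i j with h | h
      · exact Or.inl ⟨h.1, h.2.1⟩
      · exact Or.inr ⟨h.1, h.2.1⟩)
    refine ⟨σ, ax, ay, fun i j hij => ?_⟩
    have hle : i ≤ j := by rw [Fin.le_def]; omega
    have a1 := ax hle
    have a2 := ay hle
    dsimp only at a1 a2
    rcases h (σ i) (σ j) with h | h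
    · exact h.2.2
    · have e1 := le_antisymm a1 h.1
      have e2 := le_antisymm a2 h.2.1
      rw [e1, e2]

lemma exists_pos {n : ℕ} (x : ClState n) : ∃ i, 0 < x.1 i := by
  by_contra h
  push Not at h
  have : ∑ i, x.1 i = 0 := Finset.sum_eq_zero fun i _ => le_antisymm (h i) (x.2.1 i)
  rw [x.2.2] at this
  exact one_ne_zero this

lemma PW.supp {n : ℕ} {x y : ClState n} (h : PW x.1 y.1) {i : Fin n} (hi : x.1 i = 0) :
    y.1 i = 0 := by
  obtain ⟨l, hl⟩ := exists_pos x
  rcases h l i with h | h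
  · have := h.2.2
    rw [hi, zero_mul] at this
    exact le_antisymm (by nlinarith [x.2.1 i, y.2.1 i]) (y.2.1 i)
  · have := h.1; linarith

lemma PW.eq_of_eq {n : ℕ} {x y : ClState n} (h : PW x.1 y.1) {i j : Fin n}
    (hi : y.1 i ≠ 0) (hij : y.1 i = y.1 j) : x.1 i = x.1 j := by
  have h0 : 0 < y.1 j := lt_of_le_of_ne (y.2.1 j) (hij ▸ hi.symm)
  rcases h i j with h | h
  · have := h.2.2
    rw [hij] at this
    exact le_antisymm (le_of_mul_le_mul_right this h0) h.1
  · have := h.2.2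
    rw [hij] at this
    exact le_antisymm h.1 (le_of_mul_le_mul_right this h0)

lemma PW.trans {n : ℕ} {x y z : ClState n} (h : PW x.1 y.1) (h' : PW y.1 z.1) :
    PW x.1 z.1 := by
  have key : ∀ i j, PR x.1 y.1 i j → PR x.1 z.1 i j ∨ PR x.1 z.1 j i := by
    intro i j h1
    by_cases hyi : y.1 i = 0
    · have hyj : y.1 j = 0 := le_antisymm (hyi ▸ h1.2.1) (y.2.1 j)
      have z1 := h'.supp hyi
      have z2 := h'.supp hyj
      left
      refine ⟨h1.1, ?_, ?_⟩ <;> simp [z1, z2]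
    · rcases h' i j with h2 | h2
      · left
        refine ⟨h1.1, h2.2.1, ?_⟩
        have h0 : 0 < y.1 i := lt_of_le_of_ne (y.2.1 i) (Ne.symm hyi)
        have : (x.1 i * z.1 j) * y.1 i ≤ (x.1 j * z.1 i) * y.1 i := by
          nlinarith [mul_le_mul_of_nonneg_right h1.2.2 (z.2.1 i),
            mul_le_mul_of_nonneg_left h2.2.2 (x.2.1 i)]
        exact le_of_mul_le_mul_right this h0
      · have e := le_antisymm h2.1 h1.2.1
        have ex := h.eq_of_eq hyi e
        right
        refine ⟨ex.le, h2.2.1, ?_⟩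
        rw [ex]
        exact mul_le_mul_of_nonneg_left h2.2.1 (x.2.1 j)
  intro i j
  rcases h i j with h1 | h1
  · exact key i j h1
  · exact (key j i h1).symm

lemma PW.refl {n : ℕ} (x : Fin n → ℝ) : PW x x := by
  intro i j
  rcases le_total (x i) (x j) with h | h
  · right; exact ⟨h, h, (mul_comm _ _).le⟩
  · left; exact ⟨h, h, (mul_comm _ _).le⟩

/-- Consecutive levels of `x`. -/
def Adj {n : ℕ} (x : Fin n → ℝ) (i j : Fin n) : Prop :=
  x j < x i ∧ ∀ l, x l < x i → x l ≤ x j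

lemma exists_adj {n : ℕ} {x : Fin n → ℝ} {i j : Fin n} (h : x j < x i) : ∃ k, Adj x i k := by
  have hne : (Finset.univ.filter fun l => x l < x i).Nonempty := ⟨j, by simpa using h⟩
  obtain ⟨k, hk, hk'⟩ := Finset.exists_max_image _ x hne
  refine ⟨k, by simpa using hk, fun l hl => hk' l (by simpa using hl)⟩

/-- The two-level state attached to consecutive levels. -/
lemma exists_lev {n : ℕ} (x : ClState n) {i j : Fin n} (h : Adj x.1 i j) :
    ∃ (c u : ClState n) (N κ : ℝ), 0 < N ∧ 0 < κ ∧
      (∀ l, c.1 l = if x.1 i ≤ x.1 l then x.1 i * N else x.1 j * N) ∧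
      (∀ l, u.1 l = if x.1 i ≤ x.1 l then κ else 0) := by
  have hxi : 0 < x.1 i := lt_of_le_of_lt (x.2.1 j) h.1
  have gen : ∀ a b : ℝ, 0 < a → 0 ≤ b → ∃ (c : ClState n) (N : ℝ), 0 < N ∧
      ∀ l, c.1 l = if x.1 i ≤ x.1 l then a * N else b * N := by
    intro a b ha hb
    have hpos : 0 < ∑ l, (if x.1 i ≤ x.1 l then a else b) := by
      apply Finset.sum_pos'
      · intro l _; split_ifs <;> linarith
      · exact ⟨i, Finset.mem_univ _, by simpa using ha⟩
    have hN := inv_pos.2 hpos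
    refine ⟨⟨fun l => (if x.1 i ≤ x.1 l then a else b) *
      (∑ l, (if x.1 i ≤ x.1 l then a else b))⁻¹, ?_, ?_⟩, _, hN, ?_⟩
    · intro l
      apply mul_nonneg _ hN.le
      split_ifs <;> linarith
    · rw [← Finset.sum_mul]; exact mul_inv_cancel₀ hpos.ne'
    · intro l; dsimp only; split_ifs <;> rfl
  obtain ⟨c, N, hN, hc⟩ := gen (x.1 i) (x.1 j) hxi (x.2.1 j)
  obtain ⟨u, M, hM, hu⟩ := gen 1 0 one_pos le_rfl
  exact ⟨c, u, N, M, hN, hM, hc, by simpa using hu⟩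

lemma lev_le {n : ℕ} {x c : ClState n} {i j : Fin n} (h : Adj x.1 i j) {N : ℝ} (hN : 0 < N)
    (hc : ∀ l, c.1 l = if x.1 i ≤ x.1 l then x.1 i * N else x.1 j * N) : PW c.1 x.1 := by
  have key : ∀ l m, x.1 m ≤ x.1 l → PR c.1 x.1 l m := by
    intro l m hlm
    have b1 : x.1 j * N ≤ x.1 i * N := mul_le_mul_of_nonneg_right h.1.le hN.le
    have b2 := mul_nonneg (x.2.1 i) hN.le
    have b3 := mul_nonneg (x.2.1 j) hN.le
    refine ⟨?_, hlm, ?_⟩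
    · rw [hc, hc]
      split_ifs with h1 h2 <;> linarith
    · rw [hc, hc]
      split_ifs with h1 h2 h2
      · exact mul_le_mul_of_nonneg_left hlm b2
      · have := h.2 m (not_le.1 h2)
        calc x.1 i * N * x.1 m ≤ x.1 i * N * x.1 j := mul_le_mul_of_nonneg_left this b2
          _ = x.1 j * N * x.1 i := by ring
          _ ≤ x.1 j * N * x.1 l := mul_le_mul_of_nonneg_left h1 b3
      · linarith
      · exact mul_le_mul_of_nonneg_left hlm b3
  intro l m
  rcases le_total (x.1 m) (x.1 l) with h | h
  · exact Or.inl (key _ _ h)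
  · exact Or.inr (key _ _ h)

/-- If all two-level states attached to `x` are below `y` then `x` is below `y`. -/
lemma PW_of_lev {n : ℕ} {x y : ClState n}
    (H : ∀ i j, Adj x.1 i j → ∃ (c : ClState n) (N : ℝ), 0 < N ∧
      (∀ l, c.1 l = if x.1 i ≤ x.1 l then x.1 i * N else x.1 j * N) ∧ PW c.1 y.1) :
    PW x.1 y.1 := by
  have step : ∀ i j, Adj x.1 i j → ∀ m, x.1 m < x.1 i →
      y.1 m ≤ y.1 i ∧ x.1 i * y.1 m ≤ x.1 j * y.1 i := by
    intro i j hij m hm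
    obtain ⟨c, N, hN, hc, h⟩ := H i j hij
    have ci : c.1 i = x.1 i * N := by rw [hc]; simp
    have cm : c.1 m = x.1 j * N := by rw [hc]; simp [hm]
    have hlt : x.1 j * N < x.1 i * N := mul_lt_mul_of_pos_right hij.1 hN
    rcases h i m with h | h
    · refine ⟨h.2.1, ?_⟩
      have h3 := h.2.2
      rw [ci, cm] at h3
      have : (x.1 i * y.1 m) * N ≤ (x.1 j * y.1 i) * N := by linarith
      exact le_of_mul_le_mul_right this hN
    · have := h.1; rw [ci, cm] at this; linarith
  have lt : ∀ i m, x.1 m < x.1 i → y.1 m ≤ y.1 i := by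
    intro i m h
    obtain ⟨k, hk⟩ := exists_adj h
    exact (step i k hk m h).1
  obtain ⟨σ, ax, ay⟩ := exists_common_sort x.1 y.1 (fun i j => by
      rcases lt_trichotomy (x.1 i) (x.1 j) with h | h | h
      · exact Or.inr ⟨h.le, lt _ _ h⟩
      · rcases le_total (y.1 i) (y.1 j) with h' | h'
        · exact Or.inr ⟨h.le, h'⟩
        · exact Or.inl ⟨h.ge, h'⟩
      · exact Or.inl ⟨h.le, lt _ _ h⟩)
  rw [← bayes_iff x.2.1 y.2.1]
  refine ⟨σ, ax, ay, fun i j hij => ?_⟩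
  have hle : i ≤ j := by rw [Fin.le_def]; omega
  rcases (show x.1 (σ j) ≤ x.1 (σ i) from ax hle).eq_or_lt with h | h
  · rw [h]; exact mul_le_mul_of_nonneg_left (ay hle) (x.2.1 _)
  · refine (step (σ i) (σ j) ⟨h, fun l hl => ?_⟩ (σ j) h).2
    by_contra hcon
    push Not at hcon
    obtain ⟨k, rfl⟩ := σ.surjective l
    have h1 : ¬ k ≤ i := fun hk => absurd (ax hk) (not_le.2 hl)
    have h2 : ¬ j ≤ k := fun hk => absurd (ax hk) (not_le.2 hcon)
    rw [Fin.le_def] at h1 h2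
    omega

/-- The pure state at `i`. -/
def pureSt {n : ℕ} (i : Fin n) : ClState n :=
  ⟨fun l => if l = i then 1 else 0, fun l => by dsimp only; split_ifs <;> norm_num, by simp⟩

lemma pureSt_apply {n : ℕ} (i l : Fin n) : (pureSt i).1 l = if l = i then 1 else 0 := rfl

lemma PW_pure {n : ℕ} {u : ClState n} {i : Fin n} (h : ∀ l, u.1 l ≤ u.1 i) :
    PW u.1 (pureSt i).1 := by
  intro l m
  by_cases hl : l = i
  · left
    subst hl
    by_cases hm : m = l
    · subst hm; exact ⟨le_rfl, le_rfl, le_rfl⟩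
    · refine ⟨h m, ?_, ?_⟩ <;> simp [pureSt_apply, hm, u.2.1 m]
  · by_cases hm : m = i
    · right
      subst hm
      refine ⟨h l, ?_, ?_⟩ <;> simp [pureSt_apply, hl, u.2.1 l]
    · rcases le_total (u.1 l) (u.1 m) with h | h
      · right; refine ⟨h, ?_, ?_⟩ <;> simp [pureSt_apply, hl, hm]
      · left; refine ⟨h, ?_, ?_⟩ <;> simp [pureSt_apply, hl, hm]

lemma PW_pure_le {n : ℕ} {u : ClState n} {i : Fin n} (h : PW u.1 (pureSt i).1) (l : Fin n) :
    u.1 l ≤ u.1 i := by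
  by_cases hl : l = i
  · rw [hl]
  · rcases h i l with h | h
    · exact h.1
    · have := h.2.1
      simp [pureSt_apply, hl] at this
      linarith

lemma PW_flat {n : ℕ} {b u : ClState n} {κ : ℝ} (hκ : 0 < κ) (hu : ∀ i, u.1 i = 0 ∨ u.1 i = κ)
    (h : ∀ i, u.1 i ≠ 0 → ∀ l, b.1 l ≤ b.1 i) : PW b.1 u.1 := by
  intro l m
  rcases hu l with hl | hl <;> rcases hu m with hm | hm
  · rcases le_total (b.1 l) (b.1 m) with h | h
    · right; refine ⟨h, ?_, ?_⟩ <;> simp [hl, hm]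
    · left; refine ⟨h, ?_, ?_⟩ <;> simp [hl, hm]
  · right
    refine ⟨h m (by rw [hm]; exact hκ.ne') l, by rw [hl, hm]; exact hκ.le, ?_⟩
    rw [hl, hm]; simpa using mul_nonneg (b.2.1 l) hκ.le
  · left
    refine ⟨h l (by rw [hl]; exact hκ.ne') m, by rw [hl, hm]; exact hκ.le, ?_⟩
    rw [hl, hm]; simpa using mul_nonneg (b.2.1 m) hκ.le
  · have h1 := h m (by rw [hm]; exact hκ.ne') l
    have h2 := h l (by rw [hl]; exact hκ.ne') m
    have e := le_antisymm h1 h2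
    left
    refine ⟨h2, by rw [hl, hm], by rw [hl, hm, e]⟩

lemma PW_flat_max {n : ℕ} {b u : ClState n} (h : PW b.1 u.1) {κ : ℝ} (hκ : 0 < κ)
    (hu : ∀ i, u.1 i = 0 ∨ u.1 i = κ) {i : Fin n} (hi : u.1 i ≠ 0) (l : Fin n) :
    b.1 l ≤ b.1 i := by
  have hi' : u.1 i = κ := (hu i).resolve_left hi
  rcases h i l with h1 | h1
  · exact h1.1
  · rcases hu l with hl | hl
    · have := h1.2.1; rw [hl, hi'] at this; linarith
    · exact (h.eq_of_eq hi (hi'.trans hl.symm)).ge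

lemma core_way {n : ℕ} {s u c : ClState n} (h : PW s.1 u.1) {κ a β : ℝ} (hκ : 0 < κ)
    (hu : ∀ i, u.1 i = 0 ∨ u.1 i = κ) (hβ : 0 < β) (hab : β ≤ a)
    (hc : ∀ i, c.1 i = if u.1 i = 0 then β else a) (hn : ¬ PW c.1 s.1) :
    ∑ l, s.1 l * u.1 l ≤ κ * (1 - β / a / n) := by
  have ha : 0 < a := lt_of_lt_of_le hβ hab
  obtain ⟨i, j, hi, hj, hij⟩ : ∃ i j, u.1 i ≠ 0 ∧ u.1 j = 0 ∧ β * s.1 i < a * s.1 j := by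
    by_contra hcon
    push Not at hcon
    apply hn
    intro l m
    by_cases hl : u.1 l = 0 <;> by_cases hm : u.1 m = 0
    · rcases le_total (s.1 l) (s.1 m) with h | h
      · right; refine ⟨by simp [hc, hl, hm], h, ?_⟩
        simp only [hc, hl, hm, if_true]; exact mul_le_mul_of_nonneg_left h hβ.le
      · left; refine ⟨by simp [hc, hl, hm], h, ?_⟩
        simp only [hc, hl, hm, if_true]; exact mul_le_mul_of_nonneg_left h hβ.le
    · right
      refine ⟨by simp [hc, hl, hm, hab], PW_flat_max h hκ hu hm l, ?_⟩
      simpa only [hc, hl, hm, if_true, if_false] using hcon m l hm hl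
    · left
      refine ⟨by simp [hc, hl, hm, hab], PW_flat_max h hκ hu hl m, ?_⟩
      simpa only [hc, hl, hm, if_true, if_false] using hcon l m hl hm
    · have e := le_antisymm (PW_flat_max h hκ hu hl m) (PW_flat_max h hκ hu hm l)
      left
      refine ⟨by simp [hc, hl, hm], e.le, ?_⟩
      simp [hc, hl, hm, e]
  have hn0 : (0 : ℝ) < n := by
    have := i.pos; exact_mod_cast this
  have hsi : 1 / (n : ℝ) ≤ s.1 i := by
    rw [div_le_iff₀ hn0]
    have : ∑ l, s.1 l ≤ ∑ _l : Fin n, s.1 i :=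
      Finset.sum_le_sum fun l _ => PW_flat_max h hκ hu hi l
    rw [s.2.2] at this
    simp at this
    linarith
  have hsj : β / a / n ≤ s.1 j := by
    have : β / a / n = (β * (1 / n)) / a := by field_simp
    rw [this, div_le_iff₀ ha]
    have := mul_le_mul_of_nonneg_left hsi hβ.le
    linarith
  have hsum : ∑ l, s.1 l * u.1 l ≤ ∑ l, (κ * s.1 l - if l = j then κ * s.1 j else 0) := by
    apply Finset.sum_le_sum
    intro l _
    split_ifs with hl
    · subst hl; rw [hj]; simp
    · rcases hu l with h | h <;> rw [h]
      · simpa using mul_nonneg hκ.le (s.2.1 l)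
      · linarith
  rw [Finset.sum_sub_distrib, ← Finset.mul_sum, s.2.2] at hsum
  simp at hsum
  nlinarith

end Classical

section Abstract

variable {n : ℕ} {α Ω : Type} [TopologicalSpace α]
  (le : α → α → Prop) (d : Ω → ClState n → α)

/-- A state space all of whose elements are classical states seen in some frame. -/
structure FrameSys : Prop where
  surj : ∀ a, ∃ ω x, a = d ω x
  le_iff : ∀ a b, le a b ↔ ∃ ω x y, a = d ω x ∧ b = d ω y ∧ PW x.1 y.1
  reidx : ∀ ω ω', ∃ p : Fin n → Fin n, ∀ x x', d ω x = d ω' x' → ∀ i, x'.1 i = x.1 (p i)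
  fc : ∀ ω ω' x x', d ω x = d ω' x' → ∀ (f : ℝ → ℝ) (y : ClState n), (∀ i, y.1 i = f (x.1 i)) →
    ∃ y' : ClState n, (∀ i, y'.1 i = f (x'.1 i)) ∧ d ω y = d ω' y'
  trans : ∀ a b c, le a b → le b c → le a c
  closed : ∀ a, IsClosed {b | le a b}
  func : ∀ a, ∃ T : α → ℝ, Continuous T ∧ ∀ ω u s, a = d ω u → T (d ω s) = ∑ i, s.1 i * u.1 i
  joint : ∀ ω x b, (∀ i j, x.1 i ≠ x.1 j → ∃ c : ClState n, c.1 i ≠ c.1 j ∧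
      ∃ ω' c' b', d ω c = d ω' c' ∧ b = d ω' b') →
    ∃ ω' x' b', d ω x = d ω' x' ∧ b = d ω' b'

variable {le d}

lemma FrameSys.le_dd (F : FrameSys le d) {ω : Ω} {x y : ClState n} :
    le (d ω x) (d ω y) ↔ PW x.1 y.1 := by
  constructor
  · intro h
    obtain ⟨ω', x', y', hx, hy, h⟩ := (F.le_iff _ _).1 h
    obtain ⟨p, hp⟩ := F.reidx ω' ω
    intro i j
    have := h (p i) (p j)
    simpa only [PR, hp _ _ hx.symm, hp _ _ hy.symm] using this
  · intro h
    exact (F.le_iff _ _).2 ⟨ω, x, y, rfl, rfl, h⟩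

lemma FrameSys.pure_max (F : FrameSys le d) (ω : Ω) (i : Fin n) :
    d ω (pureSt i) ∈ MaxElts le := by
  intro b hb
  obtain ⟨ω', x', y', hx, hy, h⟩ := (F.le_iff _ _).1 hb
  obtain ⟨p, hp⟩ := F.reidx ω ω'
  obtain ⟨l, hl⟩ := exists_pos x'
  have hxl : x'.1 l = 1 := by
    have e := hp _ _ hx l
    rw [pureSt_apply] at e
    split_ifs at e
    · exact e
    · exact absurd e hl.ne'
  have hx0 : ∀ m, m ≠ l → x'.1 m = 0 := by
    intro m hm
    have h1 : x'.1 l + x'.1 m ≤ ∑ k, x'.1 k := by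
      have := Finset.sum_le_sum_of_subset_of_nonneg (f := x'.1) (Finset.subset_univ {l, m})
        (fun i _ _ => x'.2.1 i)
      rwa [Finset.sum_pair hm.symm] at this
    rw [x'.2.2, hxl] at h1
    have := x'.2.1 m
    linarith
  have hyx : y' = x' := by
    apply Subtype.ext
    funext m
    by_cases hm : m = l
    · subst hm
      rw [hxl, ← y'.2.2]
      rw [Finset.sum_eq_single m]
      · intro k _ hk; exact h.supp (hx0 k hk)
      · simp
    · rw [hx0 m hm]; exact h.supp (hx0 m hm)
  rw [hy, hyx, hx]

lemma FrameSys.irr (F : FrameSys le d) (ω : Ω) {u : ClState n} {κ : ℝ} (hκ : 0 < κ)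
    (hu : ∀ i, u.1 i = 0 ∨ u.1 i = κ) : d ω u ∈ Irr le := by
  refine ⟨fun s hs => hs.1, fun b hb => ?_⟩
  have hpure : ∀ (ω : Ω) (u : ClState n), (∀ i, u.1 i = 0 ∨ u.1 i = κ) → ∀ i, u.1 i ≠ 0 →
      le (d ω u) (d ω (pureSt i)) := by
    intro ω u hu i hi
    rw [F.le_dd]
    apply PW_pure
    intro l
    rw [(hu i).resolve_left hi]
    rcases hu l with h | h <;> rw [h]
    exact hκ.le
  have hb1 : ∀ i, u.1 i ≠ 0 → ∃ ω' c' b', d ω (pureSt i) = d ω' c' ∧ b = d ω' b' := by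
    intro i hi
    obtain ⟨ω', x, y, h1, h2, -⟩ := (F.le_iff _ _).1
      (hb (d ω (pureSt i)) ⟨hpure ω u hu i hi, F.pure_max ω i⟩)
    exact ⟨ω', y, x, h2, h1⟩
  obtain ⟨ω', u', b', e1, e2⟩ := F.joint ω u b (by
    intro i j hij
    by_cases hi : u.1 i = 0
    · have hj : u.1 j ≠ 0 := fun h => hij (hi.trans h.symm)
      refine ⟨pureSt j, ?_, hb1 j hj⟩
      have : i ≠ j := fun h => hij (by rw [h])
      simp [pureSt_apply, this]
    · refine ⟨pureSt i, ?_, hb1 i hi⟩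
      have : j ≠ i := fun h => hij (by rw [h])
      simp [pureSt_apply, this])
  obtain ⟨p, hp⟩ := F.reidx ω ω'
  have hu' : ∀ i, u'.1 i = 0 ∨ u'.1 i = κ := fun i => by rw [hp _ _ e1]; exact hu _
  rw [e1] at hb ⊢
  rw [e2, F.le_dd]
  refine PW_flat hκ hu' fun i hi l => ?_
  have := hb (d ω' (pureSt i)) ⟨hpure ω' u' hu' i hi, F.pure_max ω' i⟩
  rw [e2, F.le_dd] at this
  exact PW_pure_le this l

variable [CompactSpace α]

lemma FrameSys.exists_ub (F : FrameSys le d) (S : Set α) (hS : S.Nonempty)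
    (hd : DirectedOn le S) (K : Set α) (hK : IsClosed K) (hSK : S ⊆ K) :
    ∃ z ∈ K, ∀ s ∈ S, le s z := by
  have : Nonempty S := hS.to_subtype
  have hr : ∀ a, le a a := by
    intro a
    obtain ⟨ω, x, rfl⟩ := F.surj a
    exact F.le_dd.2 (PW.refl _)
  have hne := IsCompact.nonempty_iInter_of_directed_nonempty_isCompact_isClosed
    (fun s : S => {b | le s.1 b} ∩ K) (by
      intro s t
      obtain ⟨w, hw, h1, h2⟩ := hd s.1 s.2 t.1 t.2
      exact ⟨⟨w, hw⟩, fun z hz => ⟨F.trans _ _ _ h1 hz.1, hz.2⟩,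
        fun z hz => ⟨F.trans _ _ _ h2 hz.1, hz.2⟩⟩)
    (fun s => ⟨s.1, hr _, hSK s.2⟩)
    (fun s => ((F.closed s.1).inter hK).isCompact)
    (fun s => (F.closed s.1).inter hK)
  obtain ⟨z, hz⟩ := hne
  rw [Set.mem_iInter] at hz
  exact ⟨z, (hz ⟨_, hS.some_mem⟩).2, fun s hs => (hz ⟨s, hs⟩).1⟩

lemma FrameSys.way (F : FrameSys le d) (ω : Ω) {u c : ClState n} {κ a β : ℝ} (hκ : 0 < κ)
    (hu : ∀ i, u.1 i = 0 ∨ u.1 i = κ) (hβ : 0 < β) (hab : β ≤ a)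
    (hc : ∀ i, c.1 i = if u.1 i = 0 then β else a) : WayBelow le (d ω c) (d ω u) := by
  intro S hS hd hlub
  by_contra hcon
  push Not at hcon
  obtain ⟨T, hT, hT'⟩ := F.func (d ω u)
  have ha : 0 < a := lt_of_lt_of_le hβ hab
  have hn0 : (0 : ℝ) < n := by
    obtain ⟨i, -⟩ := exists_pos u
    have := i.pos; exact_mod_cast this
  obtain ⟨z, hz, hzS⟩ := F.exists_ub S hS hd {z | T z ≤ κ * (1 - β / a / n)}
    (isClosed_le hT continuous_const) (by
      intro s hs
      obtain ⟨ω', s', u', e1, e2, h⟩ := (F.le_iff _ _).1 (hlub.1 s hs)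
      obtain ⟨p, hp⟩ := F.reidx ω ω'
      have hu' : ∀ i, u'.1 i = 0 ∨ u'.1 i = κ := fun i => by rw [hp _ _ e2]; exact hu _
      obtain ⟨c', hc', e3⟩ := F.fc ω ω' u u' e2 (fun t => if t = 0 then β else a) c hc
      have hns := hcon s hs
      rw [e3, e1, F.le_dd] at hns
      have := core_way h hκ hu' hβ hab hc' hns
      rw [← hT' ω' u' s' e2, ← e1] at this
      exact this)
  obtain ⟨ω', u', z', e1, e2, h⟩ := (F.le_iff _ _).1 (hlub.2 z hzS)
  obtain ⟨p, hp⟩ := F.reidx ω ω'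
  have hu' : ∀ i, u'.1 i = 0 ∨ u'.1 i = κ := fun i => by rw [hp _ _ e1]; exact hu _
  have hz1 : T z = κ := by
    rw [e2, hT' ω' u' z' e1]
    calc ∑ i, z'.1 i * u'.1 i = ∑ i, z'.1 i * κ := by
          apply Finset.sum_congr rfl
          intro i _
          rcases hu' i with hi | hi
          · rw [h.supp hi]; simp
          · rw [hi]
      _ = κ := by rw [← Finset.sum_mul, z'.2.2, one_mul]
  have hz2 : T z ≤ κ * (1 - β / a / n) := hz
  have : 0 < κ * (β / a / n) := by positivity
  linarith

lemma FrameSys.lev_coord (F : FrameSys le d) (ω : Ω) {x : ClState n} {i j : Fin n}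
    (h : Adj x.1 i j) : ∃ (c : ClState n) (N : ℝ), 0 < N ∧
      (∀ l, c.1 l = if x.1 i ≤ x.1 l then x.1 i * N else x.1 j * N) ∧
      IsCoordinate le (d ω c) ∧ le (d ω c) (d ω x) := by
  obtain ⟨c, u, N, κ, hN, hκ, hc, hu⟩ := exists_lev x h
  refine ⟨c, N, hN, hc, ?_, F.le_dd.2 (lev_le h hN hc)⟩
  have hxi : 0 < x.1 i := lt_of_le_of_lt (x.2.1 j) h.1
  by_cases hj : x.1 j = 0
  · left
    refine F.irr ω (mul_pos hxi hN) (fun l => ?_)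
    rw [hc l, hj]
    split_ifs <;> simp
  · right
    refine ⟨d ω u, F.irr ω hκ (fun l => ?_), F.way ω (a := x.1 i * N) (β := x.1 j * N) hκ
      (fun l => ?_) (mul_pos (lt_of_le_of_ne (x.2.1 j) (Ne.symm hj)) hN)
      (mul_le_mul_of_nonneg_right h.1.le hN.le) (fun l => ?_)⟩
    · rw [hu]; split_ifs <;> simp
    · rw [hu]; split_ifs <;> simp
    · rw [hc, hu]
      split_ifs with h1 h2 h2
      · exact absurd h2 hκ.ne'
      · rfl
      · rfl
      · exact absurd rfl h2

theorem FrameSys.main (F : FrameSys le d) (a : α) :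
    IsLub' le {c | IsCoordinate le c ∧ le c a} a := by
  refine ⟨fun s hs => hs.2, fun b hb => ?_⟩
  obtain ⟨ω, x, rfl⟩ := F.surj a
  obtain ⟨ω', x', b', e1, e2⟩ := F.joint ω x b (by
    have key : ∀ i j, x.1 j < x.1 i → ∃ c : ClState n, c.1 i ≠ c.1 j ∧
        ∃ ω' c' b', d ω c = d ω' c' ∧ b = d ω' b' := by
      intro i j hij
      obtain ⟨k, hk⟩ := exists_adj hij
      obtain ⟨c, N, hN, hc, h1, h2⟩ := F.lev_coord ω hk
      refine ⟨c, ?_, ?_⟩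
      · rw [hc, hc, if_pos le_rfl, if_neg (not_le.2 hij)]
        exact (mul_lt_mul_of_pos_right hk.1 hN).ne'
      · obtain ⟨ω', c', b', h3, h4, -⟩ := (F.le_iff _ _).1 (hb _ ⟨h1, h2⟩)
        exact ⟨ω', c', b', h3, h4⟩
    intro i j hij
    rcases lt_or_gt_of_ne hij with h | h
    · obtain ⟨c, h1, h2⟩ := key j i h
      exact ⟨c, h1.symm, h2⟩
    · exact key i j h)
  rw [e1] at hb ⊢
  rw [e2, F.le_dd]
  apply PW_of_lev
  intro i j hij
  obtain ⟨c, N, hN, hc, h1, h2⟩ := F.lev_coord ω' hij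
  refine ⟨c, N, hN, hc, ?_⟩
  have := hb _ ⟨h1, h2⟩
  rwa [e2, F.le_dd] at this

end Abstract

section ClassicalInstance

instance clTop (n : ℕ) : TopologicalSpace (ClState n) :=
  inferInstanceAs (TopologicalSpace {x : Fin n → ℝ // IsClassicalState n x})

instance clT2 (n : ℕ) : T2Space (ClState n) :=
  inferInstanceAs (T2Space {x : Fin n → ℝ // IsClassicalState n x})

instance clCompact (n : ℕ) : CompactSpace (ClState n) :=
  isCompact_iff_compactSpace.1 (isCompact_stdSimplex ℝ (Fin n))

lemma cl_cont_val (n : ℕ) : Continuous (fun x : ClState n => x.1) := continuous_subtype_val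

lemma cl_cont_apply {n : ℕ} (i : Fin n) : Continuous (fun x : ClState n => x.1 i) :=
  (continuous_apply i).comp (cl_cont_val n)

lemma isClosed_PW {n : ℕ} {X : Type*} [TopologicalSpace X] {f g : X → ClState n}
    (hf : Continuous f) (hg : Continuous g) : IsClosed {z | PW (f z).1 (g z).1} := by
  have cf : ∀ i, Continuous fun z => (f z).1 i := fun i => (cl_cont_apply i).comp hf
  have cg : ∀ i, Continuous fun z => (g z).1 i := fun i => (cl_cont_apply i).comp hg
  have hP : ∀ i j, IsClosed {z | PR (f z).1 (g z).1 i j} := fun i j =>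
    (isClosed_le (cf j) (cf i)).inter ((isClosed_le (cg j) (cg i)).inter
      (isClosed_le ((cf i).mul (cg j)) ((cf j).mul (cg i))))
  have : {z | PW (f z).1 (g z).1} =
      ⋂ i, ⋂ j, ({z | PR (f z).1 (g z).1 i j} ∪ {z | PR (f z).1 (g z).1 j i}) := by
    ext z; simp [PW]
  rw [this]
  exact isClosed_iInter fun i => isClosed_iInter fun j => (hP i j).union (hP j i)

lemma clLE_iff {n : ℕ} (x y : ClState n) : clLE x y ↔ PW x.1 y.1 := bayes_iff x.2.1 y.2.1

lemma clFrame (n : ℕ) : FrameSys (n := n) (clLE (n := n)) (fun (_ : Unit) x => x) where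
  surj a := ⟨(), a, rfl⟩
  le_iff a b := by
    rw [clLE_iff]
    constructor
    · intro h; exact ⟨(), a, b, rfl, rfl, h⟩
    · rintro ⟨_, x, y, rfl, rfl, h⟩; exact h
  reidx _ _ := ⟨id, fun x x' h i => by
    have h' : x = x' := h
    subst h'; rfl⟩
  fc := by
    rintro _ _ x x' rfl f y h
    exact ⟨y, h, rfl⟩
  trans a b c h h' := by
    rw [clLE_iff] at *
    exact h.trans h'
  closed a := by
    simp only [clLE_iff]
    exact isClosed_PW continuous_const continuous_id
  func a := ⟨fun s => ∑ i, s.1 i * a.1 i,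
    continuous_finsetSum _ fun i _ => (cl_cont_apply i).mul continuous_const, by
      rintro _ u s rfl; rfl⟩
  joint _ x b _ := ⟨(), x, b, rfl, rfl⟩

end ClassicalInstance

section Quantum

open Matrix

variable {n : ℕ}

/-- The matrix with real spectrum `x` in the frame `U`. -/
noncomputable def dg (U : Matrix (Fin n) (Fin n) ℂ) (x : Fin n → ℝ) : Matrix (Fin n) (Fin n) ℂ :=
  U * diagonal (fun i => (x i : ℂ)) * Uᴴ

lemma un1 (U : unitaryGroup (Fin n) ℂ) : U.1ᴴ * U.1 = 1 := mem_unitaryGroup_iff'.1 U.2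
lemma un2 (U : unitaryGroup (Fin n) ℂ) : U.1 * U.1ᴴ = 1 := mem_unitaryGroup_iff.1 U.2

lemma conj_dg (U : unitaryGroup (Fin n) ℂ) (x : Fin n → ℝ) :
    U.1ᴴ * dg U.1 x * U.1 = diagonal (fun i => (x i : ℂ)) := by
  calc U.1ᴴ * dg U.1 x * U.1 = (U.1ᴴ * U.1) * diagonal (fun i => (x i : ℂ)) * (U.1ᴴ * U.1) := by
        simp only [dg, Matrix.mul_assoc]
    _ = _ := by rw [un1]; simp

lemma dg_herm (U : Matrix (Fin n) (Fin n) ℂ) (x : Fin n → ℝ) : (dg U x)ᴴ = dg U x := by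
  simp only [dg, conjTranspose_mul, conjTranspose_conjTranspose, diagonal_conjTranspose,
    Matrix.mul_assoc]
  congr 3
  funext i
  simp

lemma dg_trace (U : unitaryGroup (Fin n) ℂ) (x : Fin n → ℝ) :
    (dg U.1 x).trace = ((∑ i, x i : ℝ) : ℂ) := by
  rw [dg, Matrix.mul_assoc, trace_mul_comm, Matrix.mul_assoc, un1, Matrix.mul_one, trace_diagonal]
  simp

lemma dg_mul (U : unitaryGroup (Fin n) ℂ) (x y : Fin n → ℝ) :
    dg U.1 x * dg U.1 y = dg U.1 (fun i => x i * y i) := by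
  calc dg U.1 x * dg U.1 y = U.1 * diagonal (fun i => (x i : ℂ)) * (U.1ᴴ * U.1) *
        diagonal (fun i => (y i : ℂ)) * U.1ᴴ := by simp only [dg, Matrix.mul_assoc]
    _ = _ := by
      rw [un1, Matrix.mul_one, Matrix.mul_assoc U.1, diagonal_mul_diagonal, dg]
      simp

lemma dg_comm (U : unitaryGroup (Fin n) ℂ) (x y : Fin n → ℝ) :
    dg U.1 x * dg U.1 y = dg U.1 y * dg U.1 x := by
  rw [dg_mul, dg_mul]; congr 1; funext i; ring

lemma dg_dens (U : unitaryGroup (Fin n) ℂ) (x : ClState n) : IsDensityMatrix n (dg U.1 x.1) := by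
  refine ⟨?_, by rw [dg_trace, x.2.2]; simp⟩
  apply PosSemidef.mul_mul_conjTranspose_same
  rw [posSemidef_diagonal_iff]
  intro i
  exact_mod_cast x.2.1 i

/-- The density matrix with spectrum `x` in the frame `U`. -/
noncomputable def qd (U : unitaryGroup (Fin n) ℂ) (x : ClState n) : QState n :=
  ⟨dg U.1 x.1, dg_dens U x⟩

lemma qd_eq {U W : unitaryGroup (Fin n) ℂ} {x y : ClState n} :
    qd U x = qd W y ↔ dg U.1 x.1 = dg W.1 y.1 := Subtype.ext_iff

lemma of_isDiag (ρ : QState n) (U : unitaryGroup (Fin n) ℂ) (h : (U.1ᴴ * ρ.1 * U.1).IsDiag) :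
    ∃ x : ClState n, ρ = qd U x ∧ ∀ i, x.1 i = ((U.1ᴴ * ρ.1 * U.1) i i).re := by
  have hp : (U.1ᴴ * ρ.1 * U.1).PosSemidef := ρ.2.1.conjTranspose_mul_mul_same U.1
  have hd : ∀ i, 0 ≤ (U.1ᴴ * ρ.1 * U.1) i i := fun i => hp.diag_nonneg
  have hre : ∀ i, (U.1ᴴ * ρ.1 * U.1) i i = (((U.1ᴴ * ρ.1 * U.1) i i).re : ℂ) := by
    intro i
    have := Complex.le_def.1 (hd i)
    apply Complex.ext <;> simp
    exact this.2.symm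
  have he : ρ.1 = dg U.1 (fun i => ((U.1ᴴ * ρ.1 * U.1) i i).re) := by
    have h1 : diagonal (fun i => (((U.1ᴴ * ρ.1 * U.1) i i).re : ℂ)) = U.1ᴴ * ρ.1 * U.1 := by
      rw [← h.diagonal_diag]
      congr 1
      funext i
      simp only [h.diagonal_diag, diag_apply]
      exact (hre i).symm
    rw [dg, h1]
    calc ρ.1 = (U.1 * U.1ᴴ) * ρ.1 * (U.1 * U.1ᴴ) := by rw [un2]; simp
      _ = _ := by simp only [Matrix.mul_assoc]
  have ht := ρ.2.2
  rw [he, dg_trace] at ht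
  refine ⟨⟨fun i => ((U.1ᴴ * ρ.1 * U.1) i i).re, fun i => (Complex.le_def.1 (hd i)).1, ?_⟩,
    Subtype.ext he, fun i => rfl⟩
  exact_mod_cast ht

lemma dg_eq_iff (U W : unitaryGroup (Fin n) ℂ) (x y : Fin n → ℝ) :
    dg U.1 x = dg W.1 y ↔
      ∀ i j, (x i : ℂ) * (U.1ᴴ * W.1) i j = (U.1ᴴ * W.1) i j * (y j : ℂ) := by
  have e : (∀ i j, (x i : ℂ) * (U.1ᴴ * W.1) i j = (U.1ᴴ * W.1) i j * (y j : ℂ)) ↔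
      diagonal (fun i => (x i : ℂ)) * (U.1ᴴ * W.1) = (U.1ᴴ * W.1) * diagonal (fun i => (y i : ℂ)) := by
    rw [← Matrix.ext_iff]
    simp only [diagonal_mul, mul_diagonal]
  rw [e]
  constructor
  · intro h
    have h1 : U.1ᴴ * dg U.1 x * W.1 = U.1ᴴ * dg W.1 y * W.1 := by rw [h]
    have h2 : U.1ᴴ * dg U.1 x * W.1 = (U.1ᴴ * U.1) * (diagonal (fun i => (x i : ℂ)) * (U.1ᴴ * W.1)) := by
      simp only [dg, Matrix.mul_assoc]
    have h3 : U.1ᴴ * dg W.1 y * W.1 = (U.1ᴴ * W.1) * diagonal (fun i => (y i : ℂ)) * (W.1ᴴ * W.1) := by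
      simp only [dg, Matrix.mul_assoc]
    rw [h2, h3, un1, un1, Matrix.one_mul, Matrix.mul_one] at h1
    exact h1
  · intro h
    calc dg U.1 x = U.1 * (diagonal (fun i => (x i : ℂ)) * (U.1ᴴ * W.1)) * W.1ᴴ := by
          simp only [dg, Matrix.mul_assoc, un2, Matrix.mul_one]
      _ = (U.1 * U.1ᴴ) * dg W.1 y := by rw [h]; simp only [dg, Matrix.mul_assoc]
      _ = _ := by rw [un2, Matrix.one_mul]

lemma G_ne (U W : unitaryGroup (Fin n) ℂ) (j : Fin n) : ∃ i, (U.1ᴴ * W.1) i j ≠ 0 := by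
  by_contra h
  push Not at h
  have h1 : (U.1ᴴ * W.1)ᴴ * (U.1ᴴ * W.1) = 1 := by
    calc (U.1ᴴ * W.1)ᴴ * (U.1ᴴ * W.1) = W.1ᴴ * (U.1 * U.1ᴴ) * W.1 := by
          simp only [conjTranspose_mul, conjTranspose_conjTranspose, Matrix.mul_assoc]
      _ = 1 := by rw [un2, Matrix.mul_one, un1]
  have h2 := congrFun (congrFun h1 j) j
  rw [Matrix.mul_apply] at h2
  simp [h] at h2

lemma q_reidx (U W : unitaryGroup (Fin n) ℂ) : ∃ p : Fin n → Fin n, ∀ x x' : Fin n → ℝ,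
    dg U.1 x = dg W.1 x' → ∀ i, x' i = x (p i) := by
  choose p hp using G_ne U W
  refine ⟨p, fun x x' h i => ?_⟩
  have := (dg_eq_iff U W x x').1 h (p i) i
  rw [mul_comm] at this
  exact_mod_cast (mul_left_cancel₀ (hp i) this).symm

lemma q_fc {U W : unitaryGroup (Fin n) ℂ} {x x' : Fin n → ℝ} (h : dg U.1 x = dg W.1 x')
    (f : ℝ → ℝ) : dg U.1 (fun i => f (x i)) = dg W.1 (fun i => f (x' i)) := by
  rw [dg_eq_iff] at h ⊢
  intro i j
  have := h i j
  by_cases hG : (U.1ᴴ * W.1) i j = 0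
  · simp [hG]
  · rw [mul_comm] at this
    have e : x i = x' j := by exact_mod_cast mul_left_cancel₀ hG this
    rw [e, mul_comm]

lemma simdiag (A : Fin 3 → Matrix (Fin n) (Fin n) ℂ) (hA : ∀ k, (A k).IsHermitian)
    (hc : ∀ k l, A k * A l = A l * A k) :
    ∃ U : unitaryGroup (Fin n) ℂ, ∀ k, (U.1ᴴ * A k * U.1).IsDiag := by
  classical
  let T : Fin 3 → EuclideanSpace ℂ (Fin n) →ₗ[ℂ] EuclideanSpace ℂ (Fin n) :=
    fun k => toEuclideanLin (A k)
  have hT : ∀ k, (T k).IsSymmetric := fun k => isSymmetric_toEuclideanLin_iff.2 (hA k)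
  have hC : Pairwise (Function.onFun Commute T) := by
    intro k l _
    change T k * T l = T l * T k
    apply LinearMap.ext
    intro v
    simp only [T, Module.End.mul_apply, toEuclideanLin, toLpLin_apply, mulVec_mulVec, hc k l]
  have hV := LinearMap.IsSymmetric.directSum_isInternal_of_pairwise_commute hT hC
  have hV' := LinearMap.IsSymmetric.orthogonalFamily_iInf_eigenspaces hT
  have hn : Module.finrank ℂ (EuclideanSpace ℂ (Fin n)) = n := by simp
  let V : (Fin 3 → ℂ) → Submodule ℂ (EuclideanSpace ℂ (Fin n)) :=
    fun χ => ⨅ j, Module.End.eigenspace (T j) (χ j)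
  have hW : DirectSum.IsInternal (fun χ : {χ // V χ ≠ ⊥} => V χ.1) :=
    (DirectSum.isInternal_ne_bot_iff).2 hV
  have hW' : OrthogonalFamily ℂ (fun χ : {χ // V χ ≠ ⊥} => V χ.1)
      fun χ => (V χ.1).subtypeₗᵢ := hV'.comp Subtype.val_injective
  have : Fintype {χ // V χ ≠ ⊥} := hV.submodule_iSupIndep.fintypeNeBotOfFiniteDimensional
  let v := hW.subordinateOrthonormalBasis hn hW'
  have hv : ∀ a, ∃ χ : Fin 3 → ℂ, ∀ k, T k (v a) = χ k • v a := by
    intro a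
    refine ⟨(hW.subordinateOrthonormalBasisIndex hn a hW').1, fun k => ?_⟩
    have h1 := hW.subordinateOrthonormalBasis_subordinate hn a hW'
    have h2 := (Submodule.mem_iInf _).1 h1 k
    exact Module.End.mem_eigenspace_iff.1 h2
  choose χ hχ using hv
  let U : unitaryGroup (Fin n) ℂ := ⟨(EuclideanSpace.basisFun (Fin n) ℂ).toBasis.toMatrix v,
    (EuclideanSpace.basisFun (Fin n) ℂ).toMatrix_orthonormalBasis_mem_unitary v⟩
  have hU : ∀ i j, U.1 i j = v j i := fun i j => by
    simp [U, Module.Basis.toMatrix_apply]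
  refine ⟨U, fun k => ?_⟩
  have hAU : A k * U.1 = U.1 * diagonal (fun a => χ a k) := by
    ext i j
    rw [mul_diagonal, hU, Matrix.mul_apply]
    have := congrArg (fun w : EuclideanSpace ℂ (Fin n) => w i) (hχ j k)
    simp only [T, toEuclideanLin, toLpLin_apply, mulVec, dotProduct] at this
    simp only [hU]
    rw [mul_comm]
    simpa using this
  rw [Matrix.mul_assoc, hAU, ← Matrix.mul_assoc, un1, Matrix.one_mul]
  exact isDiag_diagonal _

end Quantum

section QuantumInstance

open Matrix

variable {n : ℕ}

instance qTop (n : ℕ) : TopologicalSpace (QState n) :=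
  inferInstanceAs (TopologicalSpace {ρ : Matrix (Fin n) (Fin n) ℂ // IsDensityMatrix n ρ})

instance qT2 (n : ℕ) : T2Space (QState n) :=
  inferInstanceAs (T2Space {ρ : Matrix (Fin n) (Fin n) ℂ // IsDensityMatrix n ρ})

lemma q_cont_val (n : ℕ) : Continuous (fun x : QState n => x.1) := continuous_subtype_val

instance unitaryCompact (n : ℕ) : CompactSpace (unitaryGroup (Fin n) ℂ) := by
  apply isCompact_iff_compactSpace.1
  have h1 : IsCompact (Set.univ.pi fun _ : Fin n => Set.univ.pi fun _ : Fin n =>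
      Metric.closedBall (0 : ℂ) 1) :=
    isCompact_univ_pi fun _ => isCompact_univ_pi fun _ => isCompact_closedBall _ _
  have h2 : IsClosed {U : Matrix (Fin n) (Fin n) ℂ | U * Uᴴ = 1} :=
    isClosed_eq (continuous_id.matrix_mul continuous_id.matrix_conjTranspose) continuous_const
  have h3 : IsClosed ((unitaryGroup (Fin n) ℂ : Set (Matrix (Fin n) (Fin n) ℂ))) := by
    convert h2 using 1
    ext U
    exact mem_unitaryGroup_iff
  refine IsCompact.of_isClosed_subset h1 h3 ?_
  intro U hU i _ j _
  simpa using entry_norm_bound_of_unitary hU i j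

lemma qd_cont : Continuous (fun z : unitaryGroup (Fin n) ℂ × ClState n => qd z.1 z.2) := by
  apply Continuous.subtype_mk
  unfold dg
  have c1 : Continuous (fun z : unitaryGroup (Fin n) ℂ × ClState n => z.1.1) :=
    continuous_subtype_val.comp continuous_fst
  refine (c1.matrix_mul (Continuous.matrix_diagonal ?_)).matrix_mul c1.matrix_conjTranspose
  exact continuous_pi fun i => Complex.continuous_ofReal.comp
    ((cl_cont_apply i).comp continuous_snd)

lemma exists_diag2 (ρ σ : QState n) (h : ρ.1 * σ.1 = σ.1 * ρ.1) :
    ∃ U x y, ρ = qd U x ∧ σ = qd U y := by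
  obtain ⟨U, hU⟩ := simdiag ![ρ.1, σ.1, σ.1] (by
    intro k; fin_cases k
    · exact ρ.2.1.1
    · exact σ.2.1.1
    · exact σ.2.1.1) (by
    intro k l; fin_cases k <;> fin_cases l <;> simp [h])
  obtain ⟨x, hx, -⟩ := of_isDiag ρ U (hU 0)
  obtain ⟨y, hy, -⟩ := of_isDiag σ U (hU 1)
  exact ⟨U, x, y, hx, hy⟩

lemma qLE_iff (a b : QState n) :
    qLE a b ↔ ∃ U x y, a = qd U x ∧ b = qd U y ∧ PW x.1 y.1 := by
  constructor
  · rintro ⟨U, hU, h1, h2, h3⟩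
    obtain ⟨x, hx, hx'⟩ := of_isDiag a ⟨U, hU⟩ h1
    obtain ⟨y, hy, hy'⟩ := of_isDiag b ⟨U, hU⟩ h2
    refine ⟨⟨U, hU⟩, x, y, hx, hy, ?_⟩
    rw [← bayes_iff x.2.1 y.2.1]
    rw [← funext hx', ← funext hy'] at h3
    exact h3
  · rintro ⟨U, x, y, rfl, rfl, h⟩
    refine ⟨U.1, U.2, ?_, ?_, ?_⟩
    · change (U.1ᴴ * dg U.1 x.1 * U.1).IsDiag
      rw [conj_dg]; exact isDiag_diagonal _
    · change (U.1ᴴ * dg U.1 y.1 * U.1).IsDiag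
      rw [conj_dg]; exact isDiag_diagonal _
    · change bayesLE (fun i => ((U.1ᴴ * dg U.1 x.1 * U.1) i i).re)
        (fun i => ((U.1ᴴ * dg U.1 y.1 * U.1) i i).re)
      simp only [conj_dg, diagonal_apply_eq, Complex.ofReal_re]
      exact (bayes_iff x.2.1 y.2.1).2 h

lemma q_surj (a : QState n) : ∃ U x, a = qd U x := by
  obtain ⟨U, x, _, h, _⟩ := exists_diag2 a a rfl
  exact ⟨U, x, h⟩

instance qCompact (n : ℕ) : CompactSpace (QState n) := by
  have hs : Function.Surjective
      (fun z : unitaryGroup (Fin n) ℂ × ClState n => qd z.1 z.2) := by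
    intro a
    obtain ⟨U, x, h⟩ := q_surj a
    exact ⟨(U, x), h.symm⟩
  exact hs.compactSpace qd_cont

lemma q_indep {U W : unitaryGroup (Fin n) ℂ} {x y x' y' : ClState n}
    (hx : qd U x = qd W x') (hy : qd U y = qd W y') (h : PW x.1 y.1) : PW x'.1 y'.1 := by
  obtain ⟨p, hp⟩ := q_reidx U W
  intro i j
  have := h (p i) (p j)
  simpa only [PR, hp _ _ (qd_eq.1 hx), hp _ _ (qd_eq.1 hy)] using this

lemma exists_factor (x y : Fin n → ℝ) (h : ∀ i j, y i ≠ 0 → y i = y j → x i = x j) :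
    ∃ f : ℝ → ℝ, ∀ i, y i ≠ 0 → x i = f (y i) := by
  classical
  refine ⟨fun t => if h : ∃ i, y i = t then x h.choose else 0, fun i hi => ?_⟩
  have hex : ∃ k, y k = y i := ⟨i, rfl⟩
  dsimp only
  rw [dif_pos hex]
  exact h _ _ hi hex.choose_spec.symm

lemma q_trans (a b c : QState n) (h1 : qLE a b) (h2 : qLE b c) : qLE a c := by
  rw [qLE_iff] at h1 h2
  obtain ⟨U, x, y, rfl, rfl, h1⟩ := h1
  obtain ⟨W, y', z, e, rfl, h2⟩ := h2
  have hxf : ∃ f : ℝ → ℝ, ∀ i, y.1 i ≠ 0 → x.1 i = f (y.1 i) :=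
    exists_factor x.1 y.1 fun i j hi hij => h1.eq_of_eq hi hij
  obtain ⟨f, hf⟩ := hxf
  have hG := (dg_eq_iff U W y.1 y'.1).1 (qd_eq.1 e)
  have hprod : dg U.1 x.1 * dg W.1 z.1 = dg W.1 (fun j => f (y'.1 j) * z.1 j) := by
    have hm : diagonal (fun i => (x.1 i : ℂ)) * (U.1ᴴ * W.1) * diagonal (fun i => (z.1 i : ℂ)) =
        (U.1ᴴ * W.1) * diagonal (fun j => ((f (y'.1 j) * z.1 j : ℝ) : ℂ)) := by
      ext i j
      rw [mul_diagonal, diagonal_mul, mul_diagonal]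
      have h := hG i j
      by_cases hz : (U.1ᴴ * W.1) i j = 0
      · simp [hz]
      · rw [mul_comm] at h
        have e' : y.1 i = y'.1 j := by exact_mod_cast mul_left_cancel₀ hz h
        by_cases hy : y'.1 j = 0
        · simp [h2.supp hy]
        · rw [hf i (by rw [e']; exact hy), e']
          push_cast
          ring
    calc dg U.1 x.1 * dg W.1 z.1 = U.1 * (diagonal (fun i => (x.1 i : ℂ)) * (U.1ᴴ * W.1) *
          diagonal (fun i => (z.1 i : ℂ))) * W.1ᴴ := by simp only [dg, Matrix.mul_assoc]
      _ = (U.1 * U.1ᴴ) * dg W.1 (fun j => f (y'.1 j) * z.1 j) := by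
        rw [hm]; simp only [dg, Matrix.mul_assoc]
      _ = _ := by rw [un2, Matrix.one_mul]
  have hac : dg U.1 x.1 * dg W.1 z.1 = dg W.1 z.1 * dg U.1 x.1 := by
    have h3 := congrArg conjTranspose hprod
    rw [conjTranspose_mul, dg_herm, dg_herm, dg_herm, ← hprod] at h3
    exact h3.symm
  have hab : dg U.1 x.1 * dg U.1 y.1 = dg U.1 y.1 * dg U.1 x.1 := dg_comm U _ _
  have hbc : dg U.1 y.1 * dg W.1 z.1 = dg W.1 z.1 * dg U.1 y.1 := by
    rw [qd_eq.1 e]; exact dg_comm W _ _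
  obtain ⟨R, hR⟩ := simdiag ![dg U.1 x.1, dg U.1 y.1, dg W.1 z.1] (by
    intro k; fin_cases k <;> exact dg_herm _ _) (by
    intro k l; fin_cases k <;> fin_cases l <;> simp [hab, hbc, hac])
  obtain ⟨x₁, hx, -⟩ := of_isDiag (qd U x) R (hR 0)
  obtain ⟨y₁, hy, -⟩ := of_isDiag (qd U y) R (hR 1)
  obtain ⟨z₁, hz, -⟩ := of_isDiag (qd W z) R (hR 2)
  rw [qLE_iff]
  exact ⟨R, x₁, z₁, hx, hz, (q_indep hx hy h1).trans (q_indep (e.symm.trans hy) hz h2)⟩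

lemma q_closed (a : QState n) : IsClosed {b | qLE a b} := by
  have c1 : Continuous (fun w : unitaryGroup (Fin n) ℂ × ClState n × ClState n => w.2.1) :=
    continuous_fst.comp continuous_snd
  have c2 : Continuous (fun w : unitaryGroup (Fin n) ℂ × ClState n × ClState n => w.2.2) :=
    continuous_snd.comp continuous_snd
  have c3 : Continuous
      (fun w : unitaryGroup (Fin n) ℂ × ClState n × ClState n => qd w.1 w.2.1) :=
    Continuous.comp (g := fun z : unitaryGroup (Fin n) ℂ × ClState n => qd z.1 z.2)
      (f := fun w : unitaryGroup (Fin n) ℂ × ClState n × ClState n => (w.1, w.2.1))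
      qd_cont (continuous_fst.prodMk c1)
  have c4 : Continuous
      (fun w : unitaryGroup (Fin n) ℂ × ClState n × ClState n => qd w.1 w.2.2) :=
    Continuous.comp (g := fun z : unitaryGroup (Fin n) ℂ × ClState n => qd z.1 z.2)
      (f := fun w : unitaryGroup (Fin n) ℂ × ClState n × ClState n => (w.1, w.2.2))
      qd_cont (continuous_fst.prodMk c2)
  have hS1 : IsClosed {w : unitaryGroup (Fin n) ℂ × ClState n × ClState n |
      a = qd w.1 w.2.1} := isClosed_eq continuous_const c3
  have hS2 : IsClosed {w : unitaryGroup (Fin n) ℂ × ClState n × ClState n |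
      PW w.2.1.1 w.2.2.1} := isClosed_PW c1 c2
  have hS : IsClosed {w : unitaryGroup (Fin n) ℂ × ClState n × ClState n |
      a = qd w.1 w.2.1 ∧ PW w.2.1.1 w.2.2.1} := hS1.inter hS2
  have hI := (hS.isCompact.image c4).isClosed
  convert hI using 1
  ext b
  simp only [Set.mem_ofPred_eq, qLE_iff, Set.mem_image, Prod.exists]
  constructor
  · rintro ⟨U, x, y, h1, h2, h3⟩; exact ⟨U, x, y, ⟨h1, h3⟩, h2.symm⟩
  · rintro ⟨U, x, y, ⟨h1, h3⟩, h2⟩; exact ⟨U, x, y, h1, h2.symm, h3⟩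

lemma q_joint (U : unitaryGroup (Fin n) ℂ) (x : ClState n) (b : QState n)
    (H : ∀ i j, x.1 i ≠ x.1 j → ∃ c : ClState n, c.1 i ≠ c.1 j ∧
      ∃ U' c' b', qd U c = qd U' c' ∧ b = qd U' b') :
    ∃ U' x' b', qd U x = qd U' x' ∧ b = qd U' b' := by
  apply exists_diag2
  change dg U.1 x.1 * b.1 = b.1 * dg U.1 x.1
  have hB : b.1 = U.1 * (U.1ᴴ * b.1 * U.1) * U.1ᴴ := by
    calc b.1 = (U.1 * U.1ᴴ) * b.1 * (U.1 * U.1ᴴ) := by rw [un2]; simp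
      _ = _ := by simp only [Matrix.mul_assoc]
  have e1 : ∀ c : Fin n → ℝ, U.1ᴴ * (dg U.1 c * b.1) * U.1 =
      diagonal (fun i => (c i : ℂ)) * (U.1ᴴ * b.1 * U.1) := by
    intro c
    calc _ = (U.1ᴴ * U.1) * diagonal (fun i => (c i : ℂ)) * (U.1ᴴ * b.1 * U.1) := by
          simp only [dg, Matrix.mul_assoc]
      _ = _ := by rw [un1, Matrix.one_mul]
  have e2 : ∀ c : Fin n → ℝ, U.1ᴴ * (b.1 * dg U.1 c) * U.1 =
      (U.1ᴴ * b.1 * U.1) * diagonal (fun i => (c i : ℂ)) := by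
    intro c
    calc _ = (U.1ᴴ * b.1 * U.1) * diagonal (fun i => (c i : ℂ)) * (U.1ᴴ * U.1) := by
          simp only [dg, Matrix.mul_assoc]
      _ = _ := by rw [un1, Matrix.mul_one]
  have hm : diagonal (fun i => (x.1 i : ℂ)) * (U.1ᴴ * b.1 * U.1) =
      (U.1ᴴ * b.1 * U.1) * diagonal (fun i => (x.1 i : ℂ)) := by
    ext i j
    rw [diagonal_mul, mul_diagonal]
    by_cases hij : x.1 i = x.1 j
    · rw [hij, mul_comm]
    · obtain ⟨c, hc, U', c', b', h1, h2⟩ := H i j hij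
      have hcomm : dg U.1 c.1 * b.1 = b.1 * dg U.1 c.1 := by
        rw [qd_eq.1 h1, h2]; exact dg_comm U' _ _
      have h3 := e1 c.1
      rw [hcomm, e2] at h3
      have h4 := congrFun (congrFun h3 i) j
      rw [diagonal_mul, mul_diagonal, mul_comm] at h4
      have h5 : (U.1ᴴ * b.1 * U.1) i j = 0 := by
        by_contra hne
        exact hc (by exact_mod_cast (mul_right_cancel₀ hne h4).symm)
      rw [h5]; simp
  rw [← e1, ← e2] at hm
  have h6 : ∀ M : Matrix (Fin n) (Fin n) ℂ, U.1 * (U.1ᴴ * M * U.1) * U.1ᴴ = M := by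
    intro M
    calc _ = (U.1 * U.1ᴴ) * M * (U.1 * U.1ᴴ) := by simp only [Matrix.mul_assoc]
      _ = _ := by rw [un2]; simp
  rw [← h6 (dg U.1 x.1 * b.1), hm, h6]

lemma qFrame (n : ℕ) : FrameSys (n := n) (qLE (n := n)) (qd (n := n)) where
  surj := q_surj
  le_iff := qLE_iff
  reidx U W := by
    obtain ⟨p, hp⟩ := q_reidx U W
    exact ⟨p, fun x x' h => hp _ _ (qd_eq.1 h)⟩
  fc := by
    intro U W x x' h f y hy
    have e := q_fc (qd_eq.1 h) f
    rw [← funext hy] at e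
    have ht := (qd U y).2.2
    change (dg U.1 y.1).trace = 1 at ht
    rw [e, dg_trace] at ht
    obtain ⟨p, hp⟩ := q_reidx U W
    refine ⟨⟨fun i => f (x'.1 i), fun i => ?_, by exact_mod_cast ht⟩, fun i => rfl, qd_eq.2 e⟩
    dsimp only
    rw [hp _ _ (qd_eq.1 h) i, ← hy]
    exact y.2.1 _
  trans := q_trans
  closed := q_closed
  func a := by
    refine ⟨fun s => ((s.1 * a.1).trace).re, ?_, ?_⟩
    · exact Complex.continuous_re.comp
        (((q_cont_val n).matrix_mul continuous_const).matrix_trace)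
    · rintro U u s rfl
      change ((dg U.1 s.1 * dg U.1 u.1).trace).re = _
      rw [dg_mul, dg_trace, Complex.ofReal_re]
  joint := q_joint

end QuantumInstance

/-- In both (Δⁿ, ⊑) and (Ωⁿ, ⊑), every state is the supremum of the
coordinates below it. -/
theorem every_state_is_sup_of_coordinates (n : ℕ) (hn : 2 ≤ n) :
    (∀ x : ClState n,
      IsLub' clLE {c : ClState n | IsCoordinate clLE c ∧ clLE c x} x) ∧
    (∀ ρ : QState n,
      IsLub' qLE {c : QState n | IsCoordinate qLE c ∧ qLE c ρ} ρ) := by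
  exact ⟨(clFrame n).main, (qFrame n).main⟩
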